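/- arXiv:1806.10926 — 4 statements merged into one kernel-verified Lean document; each statement's English description precedes it below -/
import Mathlib

section
/- Let n be a positive integer and let K, M, F be real symmetric positive definite n×n matrices. Then the 2n×2n real matrix A = [[0, M⁻¹], [−K, −F M⁻¹]] is Hurwitz, i.e., every eigenvalue λ ∈ ℂ of A (equivalently, every root of its characteristic polynomial over ℂ) satisfies Re λ < 0. -/
open Matrix
open scoped ComplexOrder

open scoped MatrixOrder Matrix.Norms.L2Operator in
/-- The complexification of a real positive definite matrix is positive definite. -/
theorem Matrix.PosDef.map_algebraMap_complex {ι : Type*} [Fintype ι] [DecidableEq ι]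
    {A : Matrix ι ι ℝ} (hA : A.PosDef) : (A.map (algebraMap ℝ ℂ)).PosDef := by
  obtain ⟨B, hB, rfl⟩ :=
    CStarAlgebra.isStrictlyPositive_iff_eq_star_mul_self.mp hA.isStrictlyPositive
  have hstar : (star B * B).map (algebraMap ℝ ℂ) =
      (B.map (algebraMap ℝ ℂ))ᴴ * B.map (algebraMap ℝ ℂ) := by
    rw [Matrix.map_mul, Matrix.star_eq_conjTranspose]
    congr 1
    ext i j
    simp
  rw [hstar]
  have hU : IsUnit (B.map (algebraMap ℝ ℂ)) := hB.map (algebraMap ℝ ℂ).mapMatrix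
  exact Matrix.PosDef.conjTranspose_mul_self _ (Matrix.mulVec_injective_of_isUnit hU)

/-- A root of a quadratic polynomial with positive coefficients has negative real part. -/
theorem Complex.re_neg_of_quadratic_eq_zero {a b c z : ℂ} (ha : 0 < a) (hb : 0 < b)
    (hc : 0 < c) (h : a * z ^ 2 + b * z + c = 0) : z.re < 0 := by
  rw [Complex.pos_iff] at ha hb hc
  obtain ⟨ha, ha'⟩ := ha
  obtain ⟨hb, hb'⟩ := hb
  obtain ⟨hc, hc'⟩ := hc
  have hre := congrArg Complex.re h
  have him := congrArg Complex.im h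
  simp only [pow_two, Complex.add_re, Complex.add_im, Complex.mul_re, Complex.mul_im,
    Complex.zero_re, Complex.zero_im, ← ha', ← hb', ← hc', zero_mul, sub_zero, add_zero] at hre him
  by_contra! hz
  have hprod : z.im * (2 * a.re * z.re + b.re) = 0 := by linear_combination him
  have hpos : 0 < 2 * a.re * z.re + b.re := by positivity
  have hzero : z.im = 0 := (mul_eq_zero.mp hprod).resolve_right hpos.ne'
  rw [hzero] at hre
  have : 0 < a.re * (z.re * z.re - 0 * 0) + b.re * z.re + c.re := by
    have : 0 ≤ a.re * (z.re * z.re) := by positivity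
    have : 0 ≤ b.re * z.re := by positivity
    linarith
  linarith

/-- **Hurwitz property of the LSH state matrix (Theorem 1 of the paper).**
If `K`, `M`, `F` are real symmetric positive definite `n×n` matrices, then every
complex eigenvalue of `A = [[0, M⁻¹], [−K, −F M⁻¹]]` has negative real part. -/
theorem lsh_state_matrix_hurwitz
    (n : ℕ) (hn : 0 < n) (K M F : Matrix (Fin n) (Fin n) ℝ)
    (hK : K.PosDef) (hM : M.PosDef) (hF : F.PosDef) :
    ∀ z ∈ spectrum ℂ ((fromBlocks 0 M⁻¹ (-K) (-(F * M⁻¹))).map (algebraMap ℝ ℂ)),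
      z.re < 0 := by
  intro z hz
  rw [← Matrix.spectrum_toLin', ← Module.End.hasEigenvalue_iff_mem_spectrum] at hz
  obtain ⟨v, hv⟩ := hz.exists_hasEigenvector
  have hv0 := hv.2
  have hv := hv.apply_eq_smul
  have hK' := hK.map_algebraMap_complex
  have hM' := hM.map_algebraMap_complex
  have hF' := hF.map_algebraMap_complex
  have hMM : M.map (algebraMap ℝ ℂ) * M⁻¹.map (algebraMap ℝ ℂ) = 1 := by
    rw [← Matrix.map_mul, Matrix.mul_nonsing_inv _ ((Matrix.isUnit_iff_isUnit_det _).mp hM.isUnit),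
      Matrix.map_one _ (map_zero _) (map_one _)]
  obtain ⟨x, p, rfl⟩ : ∃ x p, v = Sum.elim x p := ⟨_, _, (Sum.elim_comp_inl_inr v).symm⟩
  have hneg (B : Matrix (Fin n) (Fin n) ℝ) :
      (-B).map (algebraMap ℝ ℂ) = -B.map (algebraMap ℝ ℂ) := by
    ext i j; simp
  rw [Matrix.toLin'_apply, Matrix.fromBlocks_map, Matrix.fromBlocks_mulVec, hneg, hneg,
    Matrix.map_mul, Matrix.map_zero _ (map_zero _)] at hv
  generalize K.map (algebraMap ℝ ℂ) = K' at *
  generalize M.map (algebraMap ℝ ℂ) = M' at *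
  generalize F.map (algebraMap ℝ ℂ) = F' at *
  generalize M⁻¹.map (algebraMap ℝ ℂ) = W at *
  have h₁ : W *ᵥ p = z • x := by
    ext i; simpa using congrFun hv (Sum.inl i)
  have h₂ : -(K' *ᵥ x) - F' *ᵥ (W *ᵥ p) = z • p := by
    ext i; simpa [neg_mulVec, sub_eq_add_neg] using congrFun hv (Sum.inr i)
  have hp : p = z • M' *ᵥ x := by
    rw [← mulVec_smul, ← h₁, mulVec_mulVec, hMM, one_mulVec]
  have hx : x ≠ 0 := by
    rintro rfl
    apply hv0
    rw [hp]
    ext (i | i) <;> simp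
  refine Complex.re_neg_of_quadratic_eq_zero (hM'.dotProduct_mulVec_pos hx)
    (hF'.dotProduct_mulVec_pos hx) (hK'.dotProduct_mulVec_pos hx) ?_
  rw [h₁, hp, mulVec_smul] at h₂
  have h₃ := congrArg (star x ⬝ᵥ ·) h₂
  simp only [dotProduct_sub, dotProduct_neg, dotProduct_smul, smul_eq_mul] at h₃
  linear_combination -h₃
end

section
/- Let n be a positive integer and let K̃, F̃ be real symmetric positive definite n×n matrices. Then for every s ∈ ℂ with Re s ≥ 0, det(s² Iₙ + s F̃ + K̃) ≠ 0; that is, the quadratic matrix polynomial s² Iₙ + s F̃ + K̃ is invertible at every point of the closed right half-plane. -/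
open Matrix

open scoped ComplexOrder MatrixOrder Matrix.Norms.L2Operator in
/-- A real positive definite matrix stays positive definite when regarded as a complex matrix. -/
theorem Matrix.PosDef.map_algebraMap_complex_s3 {ι : Type*} [Fintype ι] {M : Matrix ι ι ℝ}
    (hM : M.PosDef) : (M.map (algebraMap ℝ ℂ)).PosDef := by
  classical
  obtain ⟨B, hB, rfl⟩ := CStarAlgebra.isStrictlyPositive_iff_eq_star_mul_self.mp
    hM.isStrictlyPositive
  rw [star_eq_conjTranspose, Matrix.map_mul, conjTranspose_map _ fun x => by simp]
  exact .conjTranspose_mul_self _ <| mulVec_injective_iff_isUnit.mpr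
    (hB.map (algebraMap ℝ ℂ).mapMatrix)

open scoped ComplexOrder in
/-- A real quadratic polynomial with positive coefficients has no zero in the closed right
half-plane. -/
theorem Complex.quadratic_ne_zero_of_re_nonneg {a b c s : ℂ} (ha : 0 < a) (hb : 0 < b)
    (hc : 0 < c) (hs : 0 ≤ s.re) : s ^ 2 * a + s * b + c ≠ 0 := by
  obtain ⟨ha, ha'⟩ := Complex.pos_iff.mp ha
  obtain ⟨hb, hb'⟩ := Complex.pos_iff.mp hb
  obtain ⟨hc, hc'⟩ := Complex.pos_iff.mp hc
  intro h
  have hre := congrArg Complex.re h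
  have him := congrArg Complex.im h
  simp only [sq, add_re, mul_re, mul_im, add_im, ← ha', ← hb', ← hc', zero_re, zero_im] at hre him
  have hy : s.im * (2 * s.re * a.re + b.re) = 0 := by linarith
  rcases mul_eq_zero.mp hy with hy | hy
  · rw [hy] at hre
    nlinarith [mul_nonneg (mul_self_nonneg s.re) ha.le, mul_nonneg hs hb.le]
  · nlinarith [mul_nonneg hs ha.le]

/-- **Nondegeneracy of the quadratic matrix pencil on the closed right half-plane.**
If `K̃`, `F̃` are real symmetric positive definite `n×n` matrices, then for every `s ∈ ℂ`
with `Re s ≥ 0`, `det(s² Iₙ + s F̃ + K̃) ≠ 0`, i.e. the matrix `s² Iₙ + s F̃ + K̃`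
(with `K̃`, `F̃` regarded as complex matrices entrywise) is invertible. -/
theorem quadratic_pencil_nonsingular_on_rhp
    (n : ℕ) (hn : 0 < n) (Kt Ft : Matrix (Fin n) (Fin n) ℝ)
    (hKt : Kt.PosDef) (hFt : Ft.PosDef) :
    ∀ s : ℂ, 0 ≤ s.re →
      (s ^ 2 • (1 : Matrix (Fin n) (Fin n) ℂ) + s • Ft.map (algebraMap ℝ ℂ) +
          Kt.map (algebraMap ℝ ℂ)).det ≠ 0 ∧
      IsUnit (s ^ 2 • (1 : Matrix (Fin n) (Fin n) ℂ) + s • Ft.map (algebraMap ℝ ℂ) +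
          Kt.map (algebraMap ℝ ℂ)) := by
  intro s hs
  have hdet : (s ^ 2 • (1 : Matrix (Fin n) (Fin n) ℂ) + s • Ft.map (algebraMap ℝ ℂ) +
      Kt.map (algebraMap ℝ ℂ)).det ≠ 0 := by
    intro h
    open scoped ComplexOrder in
    obtain ⟨v, hv, hv0⟩ := exists_mulVec_eq_zero_iff.mpr h
    refine Complex.quadratic_ne_zero_of_re_nonneg (dotProduct_star_self_pos_iff.mpr hv)
      (hFt.map_algebraMap_complex_s3.dotProduct_mulVec_pos hv)
      (hKt.map_algebraMap_complex_s3.dotProduct_mulVec_pos hv) hs ?_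
    simpa [add_mulVec, smul_mulVec, dotProduct_add, dotProduct_smul] using
      congrArg (star v ⬝ᵥ ·) hv0
  exact ⟨hdet, (isUnit_iff_isUnit_det _).mpr hdet.isUnit⟩
end

section
/- Let n, m be positive integers, let M be a real symmetric positive definite n×n matrix, K, F real n×n matrices, N a real m×n matrix with D := NᵀN positive definite, and define A = [[0, M⁻¹], [−K, −F M⁻¹]], B = [[0], [Nᵀ]]. Then B Bᵀ + A B Bᵀ Aᵀ = [[M⁻¹ D M⁻¹, −M⁻¹ D M⁻¹ Fᵀ], [−F M⁻¹ D M⁻¹, D + F M⁻¹ D M⁻¹ Fᵀ]], and this 2n×2n matrix is positive definite; consequently the pair (A, B) is controllable (the Kalman controllability matrix [B, AB, …, A^{2n−1}B] has full row rank 2n). -/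
open Matrix

/-- A Gram matrix `A * Aᵀ` of a real matrix is positive definite only if `A` has full row rank. -/
theorem rank_eq_card_of_posDef_mul_transpose {ι κ : Type*} [Fintype ι] [DecidableEq ι] [Fintype κ]
    {A : Matrix ι κ ℝ} (h : (A * Aᵀ).PosDef) : A.rank = Fintype.card ι := by
  rw [← rank_self_mul_transpose, rank_of_isUnit _ h.isUnit]

/-- The block lower triangular matrix whose columns are those of `AB` and `B` has a positive
definite Gram matrix when `P` is invertible and `NᵀN` is positive definite. -/
theorem posDef_fromBlocks_mul_transpose {ι κ : Type*} [Fintype ι] [DecidableEq ι] [Fintype κ]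
    {P F : Matrix ι ι ℝ} {N : Matrix κ ι ℝ} (hP : IsUnit P) (hD : (Nᵀ * N).PosDef) :
    (fromBlocks (P * Nᵀ) 0 (-(F * P * Nᵀ)) Nᵀ *
      (fromBlocks (P * Nᵀ) 0 (-(F * P * Nᵀ)) Nᵀ)ᵀ).PosDef := by
  have hN : Function.Injective N.mulVec := by
    refine (injective_iff_map_eq_zero N.mulVecLin).2 fun x hx => ?_
    refine mulVec_injective_of_isUnit hD.isUnit ?_
    have : N *ᵥ x = 0 := hx
    simp [← mulVec_mulVec, this]
  have hP' : Function.Injective P.vecMul := vecMul_injective_of_isUnit hP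
  rw [← conjTranspose_eq_transpose_of_trivial]
  refine PosDef.mul_conjTranspose_self _ ?_
  refine (injective_iff_map_eq_zero (vecMulLinear _)).2 fun x hx => ?_
  have hx' : x ᵥ* fromBlocks (P * Nᵀ) 0 (-(F * P * Nᵀ)) Nᵀ = 0 := hx
  rw [vecMul_fromBlocks, ← Sum.elim_zero_zero, Sum.elim_eq_iff] at hx'
  obtain ⟨h₁, h₂⟩ := hx'
  rw [vecMul_zero, zero_add, vecMul_transpose] at h₂
  have hr : x ∘ Sum.inr = 0 := hN (by rw [h₂, mulVec_zero])
  rw [hr, zero_vecMul, add_zero, ← vecMul_vecMul, vecMul_transpose] at h₁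
  have hl : x ∘ Sum.inl = 0 := hP' (by
    change _ ᵥ* P = 0 ᵥ* P
    rw [zero_vecMul]
    exact hN (by rw [h₁, mulVec_zero]))
  rw [← Sum.elim_comp_inl_inr x, hl, hr, Sum.elim_zero_zero]

/-- **Controllability of the LSH system (Lemma 2 of the paper, Eq. (contr)).**
For `M` real symmetric positive definite, `K`, `F` real `n×n`, and `N` a real `m×n`
matrix with `D = NᵀN` positive definite, with `A = [[0, M⁻¹], [−K, −F M⁻¹]]` and
`B = [[0], [Nᵀ]]`, one has
`BBᵀ + ABBᵀAᵀ = [[M⁻¹DM⁻¹, −M⁻¹DM⁻¹Fᵀ], [−FM⁻¹DM⁻¹, D + FM⁻¹DM⁻¹Fᵀ]]`,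
this matrix is positive definite, and the pair `(A, B)` is controllable: the Kalman
controllability matrix `Λ = [B, AB, …, A^{2n−1}B]` has full row rank `2n`. -/
theorem lsh_controllability
    (n m : ℕ) (hn : 0 < n) (hm : 0 < m)
    (M K F : Matrix (Fin n) (Fin n) ℝ) (N : Matrix (Fin m) (Fin n) ℝ)
    (hM : M.PosDef) (hD : (Nᵀ * N).PosDef) :
    (fromRows 0 Nᵀ * (fromRows (0 : Matrix (Fin n) (Fin m) ℝ) Nᵀ)ᵀ +
        fromBlocks 0 M⁻¹ (-K) (-(F * M⁻¹)) *
          (fromRows 0 Nᵀ * (fromRows (0 : Matrix (Fin n) (Fin m) ℝ) Nᵀ)ᵀ) *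
          (fromBlocks 0 M⁻¹ (-K) (-(F * M⁻¹)))ᵀ =
      fromBlocks (M⁻¹ * (Nᵀ * N) * M⁻¹) (-(M⁻¹ * (Nᵀ * N) * M⁻¹ * Fᵀ))
        (-(F * M⁻¹ * (Nᵀ * N) * M⁻¹)) (Nᵀ * N + F * M⁻¹ * (Nᵀ * N) * M⁻¹ * Fᵀ)) ∧
    (fromBlocks (M⁻¹ * (Nᵀ * N) * M⁻¹) (-(M⁻¹ * (Nᵀ * N) * M⁻¹ * Fᵀ))
        (-(F * M⁻¹ * (Nᵀ * N) * M⁻¹)) (Nᵀ * N + F * M⁻¹ * (Nᵀ * N) * M⁻¹ * Fᵀ)).PosDef ∧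
    (Matrix.of fun (i : Fin n ⊕ Fin n) (kj : Fin (2 * n) × Fin m) =>
        ((fromBlocks 0 M⁻¹ (-K) (-(F * M⁻¹)) ^ (kj.1 : ℕ) *
            fromRows (0 : Matrix (Fin n) (Fin m) ℝ) Nᵀ :
          Matrix (Fin n ⊕ Fin n) (Fin m) ℝ) i kj.2)).rank = 2 * n := by
  have hMt : M⁻¹ᵀ = M⁻¹ := by
    simpa using hM.inv.isHermitian.eq
  have hG : fromBlocks (M⁻¹ * (Nᵀ * N) * M⁻¹) (-(M⁻¹ * (Nᵀ * N) * M⁻¹ * Fᵀ))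
        (-(F * M⁻¹ * (Nᵀ * N) * M⁻¹)) (Nᵀ * N + F * M⁻¹ * (Nᵀ * N) * M⁻¹ * Fᵀ) =
      fromBlocks (M⁻¹ * Nᵀ) 0 (-(F * M⁻¹ * Nᵀ)) Nᵀ *
        (fromBlocks (M⁻¹ * Nᵀ) 0 (-(F * M⁻¹ * Nᵀ)) Nᵀ)ᵀ := by
    simp [fromBlocks_transpose, fromBlocks_multiply, hMt, Matrix.mul_assoc, add_comm]
  have hpos := posDef_fromBlocks_mul_transpose (F := F) hM.inv.isUnit hD
  refine ⟨?_, hG ▸ hpos, le_antisymm ?_ ?_⟩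
  · have hB : fromRows (0 : Matrix (Fin n) (Fin m) ℝ) Nᵀ *
        (fromRows (0 : Matrix (Fin n) (Fin m) ℝ) Nᵀ)ᵀ =
        fromBlocks 0 0 0 (Nᵀ * N) := by
      rw [transpose_fromRows, fromRows_mul_fromCols]
      simp
    rw [hB]
    simp [fromBlocks_transpose, fromBlocks_multiply, fromBlocks_add, hMt, Matrix.mul_assoc]
  · refine (rank_le_card_height _).trans_eq ?_
    simp [two_mul]
  · have hL := rank_eq_card_of_posDef_mul_transpose hpos
    rw [Fintype.card_sum, Fintype.card_fin, ← two_mul] at hL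
    rw [← hL]
    refine (congrArg rank ?_).trans_le (rank_submatrix_le _ id
      (Sum.elim (fun j => (⟨1, by omega⟩, j)) fun j => (⟨0, by omega⟩, j)))
    ext i j
    rcases i with i | i <;> rcases j with j | j <;>
      simp [fromBlocks_mul_fromRows, Matrix.mul_assoc]
end

section
/- Let n be a positive integer, P₀ a real symmetric positive definite n×n matrix, K an invertible real symmetric n×n matrix, and D a real symmetric positive definite n×n matrix. Then t · (P₀⁻¹ + t K D⁻¹ K)⁻¹ converges to K⁻¹ D K⁻¹ as t → +∞; i.e., the filtering covariance satisfies P(t) ~ (1/t) K⁻¹ D K⁻¹ as t → +∞. -/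
open Matrix

/-- If `B` is invertible, then `t • (A + t • B)⁻¹` tends to `B⁻¹` as `t → +∞`. -/
theorem tendsto_smul_inv_add_smul {ι : Type*} [Fintype ι] [DecidableEq ι]
    (A B : Matrix ι ι ℝ) (hB : IsUnit B.det) :
    Filter.Tendsto (fun t : ℝ => t • (A + t • B)⁻¹) Filter.atTop (nhds B⁻¹) := by
  have hsum : Filter.Tendsto (fun t : ℝ => t⁻¹ • A + B) Filter.atTop (nhds B) := by
    simpa using ((tendsto_inv_atTop_zero (𝕜 := ℝ)).smul_const A).add_const B
  have hinv : ContinuousAt Inv.inv B := by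
    apply continuousAt_matrix_inv
    rw [Ring.inverse_eq_inv']
    exact continuousAt_inv₀ hB.ne_zero
  have hdet : ∀ᶠ t : ℝ in Filter.atTop, (t⁻¹ • A + B).det ≠ 0 :=
    ((continuous_id.matrix_det.tendsto B).comp hsum).eventually_ne hB.ne_zero
  refine (hinv.tendsto.comp hsum).congr' ?_
  filter_upwards [hdet, Filter.eventually_ne_atTop 0] with t ht ht0
  have hfactor : A + t • B = t • (t⁻¹ • A + B) := by
    rw [smul_add, smul_inv_smul₀ ht0]
  have := invertibleOfNonzero ht0
  rw [hfactor, Matrix.inv_smul _ t ht.isUnit, smul_smul, mul_invOf_self, one_smul]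
  rfl

/-- **Asymptotics of the filtering covariance: `P(t) ~ (1/t) K⁻¹ D K⁻¹` as `t → +∞`.**
For a real symmetric positive definite `P₀`, an invertible real symmetric `K` and a real
symmetric positive definite `D`, one has
`t · (P₀⁻¹ + t K D⁻¹ K)⁻¹ → K⁻¹ D K⁻¹` as `t → +∞`. -/
theorem filtering_covariance_asymptotics
    (n : ℕ) (hn : 0 < n) (P₀ K D : Matrix (Fin n) (Fin n) ℝ)
    (hP₀ : P₀.PosDef) (hK : IsUnit K.det) (hKsym : Kᵀ = K) (hD : D.PosDef) :
    Filter.Tendsto (fun t : ℝ => t • (P₀⁻¹ + t • (K * D⁻¹ * K))⁻¹)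
      Filter.atTop (nhds (K⁻¹ * D * K⁻¹)) := by
  have hDdet : IsUnit D.det := hD.det_pos.ne'.isUnit
  have hB : IsUnit (K * D⁻¹ * K).det := by
    rw [det_mul, det_mul]
    exact (hK.mul (isUnit_nonsing_inv_det D hDdet)).mul hK
  have hlim : K⁻¹ * D * K⁻¹ = (K * D⁻¹ * K)⁻¹ := by
    rw [Matrix.mul_inv_rev, Matrix.mul_inv_rev, nonsing_inv_nonsing_inv D hDdet,
      Matrix.mul_assoc]
  rw [hlim]
  exact tendsto_smul_inv_add_smul P₀⁻¹ (K * D⁻¹ * K) hB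
end
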